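/- arXiv:1107.2351 — 2 statements merged into one kernel-verified Lean document; each statement's English description precedes it below -/
import Mathlib

section
/- Let Ω ⊆ ℝⁿ be open, fix z ∈ ℝⁿ and T > 0, let q be a C¹ function on Ω, and let K(x, t) = (4πt)^{−n/2} exp(−|x − z|²/(4t)) be the Euclidean heat kernel centered at z. Let φ(x, t) be a positive function on Ω × (0, T), C³ in x and C¹ in t, satisfying ∂φ/∂t = Δφ − qφ + 2⟨∇φ, ∇ₓ log K⟩. Then the vector field X(x, t) = −∇ₓ log φ(x, t) satisfies (∂/∂t − Δ)X = ∇q − 2∇_X X − (1/t)⟨∇_{(·)} X, x − z⟩ − (1/t)X on Ω × (0, T), where (∇_X X)^k = Σ_j X^j ∂_j X^k, ΔX acts componentwise, and ⟨∇_{(·)} X, x − z⟩ is the vector whose k-th component is Σ_j ∂_k X^j (x − z)^j. -/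
open scoped RealInnerProductSpace
open Set MeasureTheory

noncomputable def lap {n : ℕ} (f : EuclideanSpace ℝ (Fin n) → ℝ) (x : EuclideanSpace ℝ (Fin n)) : ℝ :=
  ∑ i, fderiv ℝ (fun y => fderiv ℝ f y (EuclideanSpace.single i 1)) x
      (EuclideanSpace.single i 1)

section helpers
variable {n : ℕ}

/-- Directional derivative. -/
noncomputable def dirD {V : Type*} [NormedAddCommGroup V] [NormedSpace ℝ V]
    (v : V) (F : V → ℝ) (p : V) : ℝ := fderiv ℝ F p v

lemma dirD_contDiffAt {V : Type*} [NormedAddCommGroup V] [NormedSpace ℝ V]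
    {m k : WithTop ℕ∞} (v : V) {F : V → ℝ} {p : V} (h : ContDiffAt ℝ k F p) (hm : m + 1 ≤ k) :
    ContDiffAt ℝ m (dirD v F) p := by
  have := h.fderiv_right hm
  exact this.clm_apply contDiffAt_const

lemma dirD_comm {V : Type*} [NormedAddCommGroup V] [NormedSpace ℝ V]
    (v w : V) {F : V → ℝ} {p : V} (h : ContDiffAt ℝ 2 F p) :
    dirD v (dirD w F) p = dirD w (dirD v F) p := by
  have hs : IsSymmSndFDerivAt ℝ F p := h.isSymmSndFDerivAt (by simp)
  have hd : DifferentiableAt ℝ (fderiv ℝ F) p :=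
    (h.fderiv_right (m := 1) (by norm_num)).differentiableAt (by norm_num)
  have key : ∀ a b : V, dirD a (dirD b F) p = fderiv ℝ (fderiv ℝ F) p a b := by
    intro a b
    have : HasFDerivAt (dirD b F) ((fderiv ℝ (fderiv ℝ F) p).flip b) p := by
      have := hd.hasFDerivAt.clm_apply (hasFDerivAt_const b p)
      refine this.congr_fderiv ?_
      ext; simp
    simp only [dirD] at this ⊢
    rw [this.fderiv]; rfl
  rw [key, key]; exact hs v w

lemma dirD_congr {V : Type*} [NormedAddCommGroup V] [NormedSpace ℝ V]
    (v : V) {F G : V → ℝ} {W : Set V} (hW : IsOpen W) (h : ∀ p ∈ W, F p = G p) :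
    ∀ p ∈ W, dirD v F p = dirD v G p := by
  intro p hp
  have : F =ᶠ[nhds p] G := Filter.eventually_of_mem (hW.mem_nhds hp) h
  simp only [dirD, this.fderiv_eq]

lemma slice_x {V : Type*} [NormedAddCommGroup V] [NormedSpace ℝ V]
    {F : V × ℝ → ℝ} {x : V} {t : ℝ} (h : DifferentiableAt ℝ F (x, t)) (v : V) :
    fderiv ℝ (fun y => F (y, t)) x v = dirD ((v, 0) : V × ℝ) F (x, t) := by
  have h1 : HasFDerivAt (fun y : V => (y, t)) (ContinuousLinearMap.inl ℝ V ℝ) x :=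
    hasFDerivAt_prodMk_left x t
  have := h.hasFDerivAt.comp x h1
  have h2 : fderiv ℝ (fun y => F (y, t)) x = _ := this.fderiv
  rw [h2]; simp [dirD]

lemma slice_t {V : Type*} [NormedAddCommGroup V] [NormedSpace ℝ V]
    {F : V × ℝ → ℝ} {x : V} {t : ℝ} (h : DifferentiableAt ℝ F (x, t)) :
    deriv (fun τ => F (x, τ)) t = dirD ((0, 1) : V × ℝ) F (x, t) := by
  have h1 : HasFDerivAt (fun y : ℝ => (x, y)) (ContinuousLinearMap.inr ℝ V ℝ) t :=
    hasFDerivAt_prodMk_right x t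
  have := h.hasFDerivAt.comp t h1
  have h2 : deriv (fun y => F (x, y)) t = _ := this.hasDerivAt.deriv
  rw [h2]; simp [dirD]

lemma gradient_coord (f : EuclideanSpace ℝ (Fin n) → ℝ) (x : EuclideanSpace ℝ (Fin n))
    (k : Fin n) : gradient f x k = fderiv ℝ f x (EuclideanSpace.single k 1) := by
  have h : ⟪gradient f x, EuclideanSpace.single k (1:ℝ)⟫ = fderiv ℝ f x (EuclideanSpace.single k 1) := by
    simp [gradient]
  rw [← h, EuclideanSpace.inner_single_right]; simp

/-- The spatial unit vectors in space-time. -/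
noncomputable def ee (i : Fin n) : EuclideanSpace ℝ (Fin n) × ℝ := (EuclideanSpace.single i 1, 0)

lemma slice_lap {F : EuclideanSpace ℝ (Fin n) × ℝ → ℝ} {Ω : Set (EuclideanSpace ℝ (Fin n))}
    (hΩ : IsOpen Ω) {x : EuclideanSpace ℝ (Fin n)} {t : ℝ} (hx : x ∈ Ω)
    (h : ∀ y ∈ Ω, ContDiffAt ℝ 2 F (y, t)) {f : EuclideanSpace ℝ (Fin n) → ℝ}
    (hf : ∀ y ∈ Ω, f y = F (y, t)) :
    lap f x = ∑ i, dirD (ee i) (dirD (ee i) F) (x, t) := by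
  unfold lap
  refine Finset.sum_congr rfl fun i _ => ?_
  have h1 : ∀ y ∈ Ω, fderiv ℝ f y (EuclideanSpace.single i 1) = dirD (ee i) F (y, t) := by
    intro y hy
    rw [show ee i = ((EuclideanSpace.single i 1, 0) : EuclideanSpace ℝ (Fin n) × ℝ) from rfl,
      ← slice_x ((h y hy).differentiableAt (by norm_num))]
    exact dirD_congr _ hΩ hf y hy
  have h2 := dirD_congr (EuclideanSpace.single i 1) hΩ h1 x hx
  unfold dirD at h2
  rw [h2]
  exact slice_x (F := dirD (ee i) F)
    ((dirD_contDiffAt (m := 1) (ee i) (h x hx) (by norm_num)).differentiableAt (by norm_num)) _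

lemma logK_grad (z x : EuclideanSpace ℝ (Fin n)) (t : ℝ) (ht : 0 < t) (k : Fin n)
    (K : EuclideanSpace ℝ (Fin n) → ℝ → ℝ)
    (hK : ∀ x t, K x t =
      (4 * Real.pi * t) ^ (-(n : ℝ) / 2) * Real.exp (-‖x - z‖ ^ 2 / (4 * t))) :
    gradient (fun y => Real.log (K y t)) x k = - (x - z) k / (2 * t) := by
  have h0 : (fun y => Real.log (K y t)) =
      fun y => Real.log ((4 * Real.pi * t) ^ (-(n : ℝ) / 2)) + (-(1 / (4 * t))) * ‖y - z‖ ^ 2 := by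
    funext y
    have : (0:ℝ) < (4 * Real.pi * t) ^ (-(n : ℝ) / 2) := by positivity
    rw [hK, Real.log_mul this.ne' (Real.exp_pos _).ne', Real.log_exp]
    ring
  rw [gradient_coord, h0]
  have h1 : HasFDerivAt (fun y : EuclideanSpace ℝ (Fin n) => y - z)
    (ContinuousLinearMap.id ℝ _) x := (hasFDerivAt_id x).sub_const z
  have h2 := (h1.norm_sq.const_mul (-(1 / (4 * t)))).const_add
    (Real.log ((4 * Real.pi * t) ^ (-(n : ℝ) / 2)))
  rw [h2.fderiv]
  simp [EuclideanSpace.inner_single_right]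
  field_simp
  ring

lemma dirD_log {V : Type*} [NormedAddCommGroup V] [NormedSpace ℝ V] (v : V)
    {F : V → ℝ} {p : V} (h : DifferentiableAt ℝ F p) (h0 : F p ≠ 0) :
    dirD v (fun p => Real.log (F p)) p = dirD v F p / F p := by
  unfold dirD
  rw [(h.hasFDerivAt.log h0).fderiv]
  simp; field_simp

lemma dirD_mul {V : Type*} [NormedAddCommGroup V] [NormedSpace ℝ V] (v : V)
    {F G : V → ℝ} {p : V} (h : DifferentiableAt ℝ F p) (h' : DifferentiableAt ℝ G p) :
    dirD v (fun p => F p * G p) p = F p * dirD v G p + G p * dirD v F p := by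
  unfold dirD
  rw [(h.hasFDerivAt.fun_mul h'.hasFDerivAt).fderiv]
  simp

lemma dirD_add {V : Type*} [NormedAddCommGroup V] [NormedSpace ℝ V] (v : V)
    {F G : V → ℝ} {p : V} (h : DifferentiableAt ℝ F p) (h' : DifferentiableAt ℝ G p) :
    dirD v (fun p => F p + G p) p = dirD v F p + dirD v G p := by
  unfold dirD
  rw [(h.hasFDerivAt.fun_add h'.hasFDerivAt).fderiv]
  simp

lemma dirD_sub {V : Type*} [NormedAddCommGroup V] [NormedSpace ℝ V] (v : V)
    {F G : V → ℝ} {p : V} (h : DifferentiableAt ℝ F p) (h' : DifferentiableAt ℝ G p) :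
    dirD v (fun p => F p - G p) p = dirD v F p - dirD v G p := by
  unfold dirD
  rw [(h.hasFDerivAt.fun_sub h'.hasFDerivAt).fderiv]
  simp

lemma dirD_neg {V : Type*} [NormedAddCommGroup V] [NormedSpace ℝ V] (v : V)
    (F : V → ℝ) (p : V) :
    dirD v (fun p => - F p) p = - dirD v F p := by
  unfold dirD
  rw [fderiv_fun_neg]; simp

lemma dirD_sum {V : Type*} [NormedAddCommGroup V] [NormedSpace ℝ V] (v : V)
    {F : Fin n → V → ℝ} {p : V} (h : ∀ i, DifferentiableAt ℝ (F i) p) :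
    dirD v (fun p => ∑ i, F i p) p = ∑ i, dirD v (F i) p := by
  unfold dirD
  rw [(HasFDerivAt.fun_sum fun i _ => (h i).hasFDerivAt).fderiv]
  simp

/-- The equation satisfied by `log φ`. -/
lemma log_pde (Ω : Set (EuclideanSpace ℝ (Fin n))) (hΩ : IsOpen Ω)
    (z : EuclideanSpace ℝ (Fin n)) (T : ℝ)
    (q : EuclideanSpace ℝ (Fin n) → ℝ)
    (K : EuclideanSpace ℝ (Fin n) → ℝ → ℝ)
    (hK : ∀ x t, K x t =
      (4 * Real.pi * t) ^ (-(n : ℝ) / 2) * Real.exp (-‖x - z‖ ^ 2 / (4 * t)))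
    (φ : EuclideanSpace ℝ (Fin n) → ℝ → ℝ)
    (hφC : ∀ p ∈ Ω ×ˢ Ioo (0:ℝ) T,
      ContDiffAt ℝ 3 (fun p : EuclideanSpace ℝ (Fin n) × ℝ => φ p.1 p.2) p)
    (hφpos : ∀ x ∈ Ω, ∀ t ∈ Ioo (0:ℝ) T, 0 < φ x t)
    (heq : ∀ x ∈ Ω, ∀ t ∈ Ioo (0:ℝ) T,
      deriv (fun τ => φ x τ) t = lap (fun y => φ y t) x - q x * φ x t
        + 2 * ⟪gradient (fun y => φ y t) x, gradient (fun y => Real.log (K y t)) x⟫)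
    (U : EuclideanSpace ℝ (Fin n) × ℝ → ℝ) (hU : U = fun p => Real.log (φ p.1 p.2))
    (hUC : ∀ p ∈ Ω ×ˢ Ioo (0:ℝ) T, ContDiffAt ℝ 3 U p) :
    ∀ p ∈ Ω ×ˢ Ioo (0:ℝ) T, dirD (0, 1) U p =
      (∑ i, dirD (ee i) (dirD (ee i) U) p) + (∑ i, dirD (ee i) U p * dirD (ee i) U p) - q p.1
        - (1 / p.2) * ∑ i, dirD (ee i) U p * (p.1 - z) i := by
  have hW : IsOpen (Ω ×ˢ Ioo (0:ℝ) T) := hΩ.prod isOpen_Ioo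
  set F : EuclideanSpace ℝ (Fin n) × ℝ → ℝ := fun p => φ p.1 p.2 with hF
  have hFd : ∀ p ∈ Ω ×ˢ Ioo (0:ℝ) T, DifferentiableAt ℝ F p :=
    fun p hp => (hφC p hp).differentiableAt (by norm_num)
  have hD : ∀ v, ∀ p ∈ Ω ×ˢ Ioo (0:ℝ) T, dirD v F p = F p * dirD v U p := by
    intro v p hp
    have hpos : F p ≠ 0 := (hφpos p.1 hp.1 p.2 hp.2).ne'
    have := dirD_log v (hFd p hp) hpos
    rw [hU, this]; field_simp
  have hDD : ∀ v, ∀ p ∈ Ω ×ˢ Ioo (0:ℝ) T, dirD v (dirD v F) p =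
      F p * (dirD v (dirD v U) p + dirD v U p * dirD v U p) := by
    intro v p hp
    rw [dirD_congr v hW (hD v) p hp, dirD_mul v (hFd p hp)
      ((dirD_contDiffAt (m := 2) v (hUC p hp) (by norm_num)).differentiableAt (by norm_num)),
      hD v p hp]
    ring
  rintro ⟨x, t⟩ hp
  have hx : x ∈ Ω := hp.1
  have ht : t ∈ Ioo (0:ℝ) T := hp.2
  have e := heq x hx t ht
  have hpos : F (x, t) ≠ 0 := (hφpos x hx t ht).ne'
  have e1 : deriv (fun τ => φ x τ) t = dirD (0, 1) F (x, t) := slice_t (F := F) (hFd _ hp)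
  have e2 : lap (fun y => φ y t) x = ∑ i, dirD (ee i) (dirD (ee i) F) (x, t) :=
    slice_lap hΩ hx (fun y hy => (hφC (y, t) ⟨hy, ht⟩).of_le (by norm_num)) (fun _ _ => rfl)
  have e3 : ⟪gradient (fun y => φ y t) x, gradient (fun y => Real.log (K y t)) x⟫ =
      ∑ i, dirD (ee i) F (x, t) * (- (x - z) i / (2 * t)) := by
    rw [PiLp.inner_apply]
    refine Finset.sum_congr rfl fun i _ => ?_
    rw [logK_grad z x t ht.1 i K hK, gradient_coord, ee, ← slice_x (hFd _ hp)]
    simp [F, mul_comm]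
  rw [e1, e2, e3] at e
  simp only [hD _ _ hp, hDD _ _ hp] at e
  have ht0 : t ≠ 0 := ht.1.ne'
  apply mul_left_cancel₀ hpos
  rw [e, ← Finset.sum_add_distrib, mul_sub, mul_sub, Finset.mul_sum, Finset.mul_sum, Finset.mul_sum,
    Finset.mul_sum, sub_eq_add_neg _ (∑ i, _), ← Finset.sum_neg_distrib]
  congr 1
  · simp only [F]; ring
  · refine Finset.sum_congr rfl fun i _ => ?_
    field_simp

end helpers

theorem stmt_15 {n : ℕ} (Ω : Set (EuclideanSpace ℝ (Fin n))) (hΩ : IsOpen Ω)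
    (z : EuclideanSpace ℝ (Fin n)) (T : ℝ) (hT : 0 < T)
    (q : EuclideanSpace ℝ (Fin n) → ℝ) (hqC : ContDiffOn ℝ 1 q Ω)
    (K : EuclideanSpace ℝ (Fin n) → ℝ → ℝ)
    (hK : ∀ x t, K x t =
      (4 * Real.pi * t) ^ (-(n : ℝ) / 2) * Real.exp (-‖x - z‖ ^ 2 / (4 * t)))
    (φ : EuclideanSpace ℝ (Fin n) → ℝ → ℝ)
    (hφC : ContDiffOn ℝ 3 (fun p : EuclideanSpace ℝ (Fin n) × ℝ => φ p.1 p.2) (Ω ×ˢ Ioo (0:ℝ) T))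
    (hφpos : ∀ x ∈ Ω, ∀ t ∈ Ioo (0:ℝ) T, 0 < φ x t)
    (heq : ∀ x ∈ Ω, ∀ t ∈ Ioo (0:ℝ) T,
      deriv (fun τ => φ x τ) t = lap (fun y => φ y t) x - q x * φ x t
        + 2 * ⟪gradient (fun y => φ y t) x, gradient (fun y => Real.log (K y t)) x⟫)
    (X : EuclideanSpace ℝ (Fin n) → ℝ → EuclideanSpace ℝ (Fin n))
    (hX : ∀ x t, X x t = -gradient (fun y => Real.log (φ y t)) x) :
    ∀ x ∈ Ω, ∀ t ∈ Ioo (0:ℝ) T, ∀ k : Fin n,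
      deriv (fun τ => X x τ k) t - lap (fun y => X y t k) x =
      gradient q x k
        - 2 * ∑ j, X x t j * fderiv ℝ (fun y => X y t k) x (EuclideanSpace.single j 1)
        - (1/t) * ∑ j, fderiv ℝ (fun y => X y t j) x (EuclideanSpace.single k 1) * (x - z) j
        - (1/t) * X x t k := by
  have hW : IsOpen (Ω ×ˢ Ioo (0:ℝ) T) := hΩ.prod isOpen_Ioo
  have hφC' : ∀ p ∈ Ω ×ˢ Ioo (0:ℝ) T,
      ContDiffAt ℝ 3 (fun p : EuclideanSpace ℝ (Fin n) × ℝ => φ p.1 p.2) p :=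
    fun p hp => hφC.contDiffAt (hW.mem_nhds hp)
  obtain ⟨U, hU⟩ : ∃ U : EuclideanSpace ℝ (Fin n) × ℝ → ℝ,
    U = fun p => Real.log (φ p.1 p.2) := ⟨_, rfl⟩
  have hUC : ∀ p ∈ Ω ×ˢ Ioo (0:ℝ) T, ContDiffAt ℝ 3 U p := by
    intro p hp
    rw [hU]
    exact (hφC' p hp).log (hφpos p.1 hp.1 p.2 hp.2).ne'
  have pde := log_pde Ω hΩ z T q K hK φ hφC' hφpos heq U hU hUC
  have hU1 : ∀ v, ∀ p ∈ Ω ×ˢ Ioo (0:ℝ) T, ContDiffAt ℝ 2 (dirD v U) p :=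
    fun v p hp => dirD_contDiffAt v (hUC p hp) (by norm_num)
  have hU2 : ∀ v w, ∀ p ∈ Ω ×ˢ Ioo (0:ℝ) T, ContDiffAt ℝ 1 (dirD v (dirD w U)) p :=
    fun v w p hp => dirD_contDiffAt v (hU1 w p hp) (by norm_num)
  have hUd : ∀ p ∈ Ω ×ˢ Ioo (0:ℝ) T, DifferentiableAt ℝ U p :=
    fun p hp => (hUC p hp).differentiableAt (by norm_num)
  have hU1d : ∀ v, ∀ p ∈ Ω ×ˢ Ioo (0:ℝ) T, DifferentiableAt ℝ (dirD v U) p :=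
    fun v p hp => (hU1 v p hp).differentiableAt (by norm_num)
  have hU2d : ∀ v w, ∀ p ∈ Ω ×ˢ Ioo (0:ℝ) T, DifferentiableAt ℝ (dirD v (dirD w U)) p :=
    fun v w p hp => (hU2 v w p hp).differentiableAt (by norm_num)
  have hXU : ∀ y ∈ Ω, ∀ s ∈ Ioo (0:ℝ) T, ∀ j, X y s j = - dirD (ee j) U (y, s) := by
    intro y hy s hs j
    rw [hX, PiLp.neg_apply, gradient_coord, ee, ← slice_x (hUd _ ⟨hy, hs⟩), hU]
  intro x hx t ht k
  have hp : (x, t) ∈ Ω ×ˢ Ioo (0:ℝ) T := ⟨hx, ht⟩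
  have hn : ∀ j, ∀ p ∈ Ω ×ˢ Ioo (0:ℝ) T, ContDiffAt ℝ 2 (fun p => - dirD (ee j) U p) p :=
    fun j p hp => (hU1 _ p hp).neg
  have hnd : ∀ j, ∀ p ∈ Ω ×ˢ Ioo (0:ℝ) T,
      DifferentiableAt ℝ (fun p => - dirD (ee j) U p) p :=
    fun j p hp => (hn j p hp).differentiableAt (by norm_num)
  have a1 : deriv (fun τ => X x τ k) t = - dirD (0, 1) (dirD (ee k) U) (x, t) := by
    have : (fun τ => X x τ k) =ᶠ[nhds t] fun τ => - dirD (ee k) U (x, τ) :=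
      Filter.eventually_of_mem (isOpen_Ioo.mem_nhds ht) fun s hs => hXU x hx s hs k
    rw [this.deriv_eq, slice_t (F := fun p => - dirD (ee k) U p) (hnd k _ hp), dirD_neg]
  have a2 : lap (fun y => X y t k) x =
      - ∑ i, dirD (ee i) (dirD (ee i) (dirD (ee k) U)) (x, t) := by
    rw [slice_lap (F := fun p => - dirD (ee k) U p) hΩ hx (fun y hy => hn k _ ⟨hy, ht⟩)
      (fun y hy => hXU y hy t ht k), ← Finset.sum_neg_distrib]
    refine Finset.sum_congr rfl fun i _ => ?_
    rw [dirD_congr (ee i) hW (fun p _ => dirD_neg (ee i) (dirD (ee k) U) p) _ hp, dirD_neg]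
  have a3 : ∀ j i, fderiv ℝ (fun y => X y t j) x (EuclideanSpace.single i 1) =
      - dirD (ee i) (dirD (ee j) U) (x, t) := by
    intro j i
    have h1 := dirD_congr (EuclideanSpace.single i 1) hΩ (fun y hy => hXU y hy t ht j) x hx
    rw [dirD] at h1
    rw [h1, dirD, slice_x (F := fun p => - dirD (ee j) U p) (hnd j _ hp), ← ee, dirD_neg]
  have hqd : DifferentiableAt ℝ q x :=
    (hqC.contDiffAt (hΩ.mem_nhds hx)).differentiableAt (by norm_num)
  have hqd' : DifferentiableAt ℝ (fun p : EuclideanSpace ℝ (Fin n) × ℝ => q p.1) (x, t) :=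
    DifferentiableAt.comp (x, t) (g := q) hqd differentiableAt_fst
  have a4 : gradient q x k = dirD (ee k) (fun p => q p.1) (x, t) := by
    rw [gradient_coord, ee, ← slice_x hqd']
  have ht0 : t ≠ 0 := ht.1.ne'
  have d1 : DifferentiableAt ℝ (fun p : EuclideanSpace ℝ (Fin n) × ℝ => 1 / p.2) (x, t) := by
    have : (x, t).2 ≠ 0 := ht0
    fun_prop (disch := assumption)
  have d2 : ∀ i, DifferentiableAt ℝ
      (fun p : EuclideanSpace ℝ (Fin n) × ℝ => (p.1 - z) i) (x, t) := by
    intro i; simp only [PiLp.sub_apply]; fun_prop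
  have v1 : dirD (ee k) (fun p : EuclideanSpace ℝ (Fin n) × ℝ => 1 / p.2) (x, t) = 0 := by
    rw [ee, ← slice_x d1]; simp
  have v2 : ∀ i, dirD (ee k) (fun p : EuclideanSpace ℝ (Fin n) × ℝ => (p.1 - z) i) (x, t)
      = if i = k then 1 else 0 := by
    intro i
    rw [ee, ← slice_x (d2 i)]
    have : HasFDerivAt (fun y : EuclideanSpace ℝ (Fin n) => (y - z) i)
        (EuclideanSpace.proj i : EuclideanSpace ℝ (Fin n) →L[ℝ] ℝ) x :=
      (EuclideanSpace.proj i : EuclideanSpace ℝ (Fin n) →L[ℝ] ℝ).hasFDerivAt.comp x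
        ((hasFDerivAt_id x).sub_const z)
    rw [this.fderiv]
    simp
  have main := dirD_congr (ee k) hW pde (x, t) hp
  have s1 : DifferentiableAt ℝ (fun p => ∑ i, dirD (ee i) (dirD (ee i) U) p) (x, t) :=
    DifferentiableAt.fun_sum fun i _ => hU2d _ _ _ hp
  have s2 : DifferentiableAt ℝ (fun p => ∑ i, dirD (ee i) U p * dirD (ee i) U p) (x, t) :=
    DifferentiableAt.fun_sum fun i _ => (hU1d _ _ hp).fun_mul (hU1d _ _ hp)
  have s3 : DifferentiableAt ℝ (fun p => ∑ i, dirD (ee i) U p * (p.1 - z) i) (x, t) :=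
    DifferentiableAt.fun_sum fun i _ => (hU1d _ _ hp).fun_mul (d2 i)
  rw [dirD_sub _ ((s1.fun_add s2).fun_sub hqd') (d1.fun_mul s3), dirD_sub _ (s1.fun_add s2) hqd',
    dirD_add _ s1 s2, dirD_mul _ d1 s3, v1, dirD_sum _ (fun i => hU2d _ _ _ hp),
    dirD_sum _ (fun i => (hU1d _ _ hp).fun_mul (hU1d _ _ hp)),
    dirD_sum _ (fun i => (hU1d _ _ hp).fun_mul (d2 i)), ← a4,
    dirD_comm _ _ ((hUC _ hp).of_le (by norm_num))] at main
  have c3 : ∀ i, dirD (ee k) (dirD (ee i) (dirD (ee i) U)) (x, t) =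
      dirD (ee i) (dirD (ee i) (dirD (ee k) U)) (x, t) := by
    intro i
    rw [dirD_comm _ _ (hU1 _ _ hp)]
    exact dirD_congr _ hW (fun p hp => dirD_comm _ _ ((hUC _ hp).of_le (by norm_num))) _ hp
  have c2 : ∀ i, dirD (ee k) (dirD (ee i) U) (x, t) = dirD (ee i) (dirD (ee k) U) (x, t) :=
    fun i => dirD_comm _ _ ((hUC _ hp).of_le (by norm_num))
  have m2 : ∀ i, dirD (ee k) (fun p => dirD (ee i) U p * dirD (ee i) U p) (x, t) =
      2 * (dirD (ee i) U (x, t) * dirD (ee i) (dirD (ee k) U) (x, t)) := by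
    intro i
    rw [dirD_mul _ (hU1d _ _ hp) (hU1d _ _ hp), ← c2]
    ring
  have m3 : ∀ i, dirD (ee k) (fun p => dirD (ee i) U p * (p.1 - z) i) (x, t) =
      (if i = k then dirD (ee i) U (x, t) else 0)
        + dirD (ee i) (dirD (ee k) U) (x, t) * (x - z) i := by
    intro i
    rw [dirD_mul _ (hU1d _ _ hp) (d2 i), v2, ← c2]
    simp only [mul_ite, mul_one, mul_zero]
    ring
  simp only [c3, m2, m3, Finset.sum_add_distrib, Finset.sum_ite_eq', Finset.mem_univ, if_true,
    ← Finset.mul_sum] at main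
  rw [a1, a2, main]
  simp only [a3, hXU x hx t ht, c2, neg_mul, mul_neg, neg_neg, Finset.sum_neg_distrib]
  ring
end

section
/- Let Ω ⊂ ℝⁿ be a bounded open set with C² boundary whose second fundamental form with respect to the outward normal is positive definite (strictly convex). Let q be C¹ on the closure of Ω and let φ₀ be a first Dirichlet eigenfunction of L_q = Δ − q with eigenvalue λ₀. Then there exists δ₁ > 0 such that for all x, y ∈ Ω whose connecting line segment is contained in the boundary layer {z ∈ Ω : φ₀(z) < δ₁}, one has (∇log φ₀(x) − ∇log φ₀(y)) · (y − x) ≥ 0; that is, −log φ₀ is convex along any segment lying entirely in the boundary layer. -/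
open scoped RealInnerProductSpace
open Set MeasureTheory

open Filter Topology in
theorem aux_unique {E : Type*} [NormedAddCommGroup E] [InnerProductSpace ℝ E] [CompleteSpace E]
    (ρ : E → ℝ) (p : E) (hd : DifferentiableAt ℝ ρ p) (hp : ρ p = 0) (hg : gradient ρ p ≠ 0) :
    UniqueDiffWithinAt ℝ {x | ρ x < 0} p := by
  set g := gradient ρ p with hgdef
  have hL : ∀ v, fderiv ℝ ρ p v = ⟪g, v⟫ := fun v => by
    rw [hgdef, gradient, InnerProductSpace.toDual_symm_apply]
  have hgn : 0 < ‖g‖ := norm_pos_iff.2 hg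
  set S : Set E := {z | ⟪g, z - p⟫ + ‖g‖ / 2 * ‖z - p‖ < 0} with hS
  have hcont : Continuous (fun z : E => ⟪g, z - p⟫ + ‖g‖ / 2 * ‖z - p‖) := by fun_prop
  have hSo : IsOpen S := isOpen_lt hcont continuous_const
  have hmem : ∀ t : ℝ, 0 < t → p - t • g ∈ S := by
    intro t ht
    have : p - t • g - p = -(t • g) := by abel
    simp only [hS, mem_setOf_eq, this, inner_neg_right, inner_smul_right, norm_neg, norm_smul,
      real_inner_self_eq_norm_sq, Real.norm_eq_abs, abs_of_pos ht]
    have : 0 < t * ‖g‖ ^ 2 := by positivity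
    nlinarith
  have hSc : Convex ℝ S := by
    intro x hx y hy a b ha hb hab
    simp only [hS, mem_setOf_eq] at hx hy ⊢
    have e : a • x + b • y - p = a • (x - p) + b • (y - p) := by
      have : p = (a + b) • p := by rw [hab, one_smul]
      nth_rw 1 [this]
      module
    rw [e, inner_add_right, inner_smul_right, inner_smul_right]
    have h1 : ‖a • (x - p) + b • (y - p)‖ ≤ a * ‖x - p‖ + b * ‖y - p‖ := by
      refine (norm_add_le _ _).trans ?_
      rw [norm_smul, norm_smul, Real.norm_of_nonneg ha, Real.norm_of_nonneg hb]
    have h2 := mul_le_mul_of_nonneg_left h1 (by positivity : 0 ≤ ‖g‖ / 2)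
    rcases ha.eq_or_lt with h | h
    · have hb1 : b = 1 := by linarith
      subst hb1; subst h; nlinarith
    · nlinarith [mul_pos_of_neg_of_neg (neg_neg_of_pos h) hx, mul_nonneg hb (neg_nonneg.2 hy.le)]
  have hcl : p ∈ closure S := by
    have ht : Tendsto (fun t : ℝ => p - t • g) (𝓝[>] 0) (𝓝 p) := by
      have : Continuous (fun t : ℝ => p - t • g) := by fun_prop
      have h := this.tendsto 0
      simp only [zero_smul, sub_zero] at h
      exact h.mono_left nhdsWithin_le_nhds
    exact mem_closure_of_tendsto ht (by
      filter_upwards [self_mem_nhdsWithin] with t ht using hmem t ht)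
  have hu : UniqueDiffWithinAt ℝ S p := uniqueDiffWithinAt_convex hSc
    (by rw [hSo.interior_eq]; exact ⟨_, hmem 1 one_pos⟩) hcl
  have hev := (hasFDerivAt_iff_isLittleO.1 hd.hasFDerivAt).def (half_pos hgn)
  refine (hu.inter hev).mono ?_
  rintro z ⟨hz, hz2⟩
  simp only [mem_setOf_eq, hp, hL, Real.norm_eq_abs] at hz2
  simp only [hS, mem_setOf_eq] at hz ⊢
  have := (abs_le.1 hz2).2
  linarith

open Filter Topology in
theorem aux_curve {E : Type*} [NormedAddCommGroup E] [InnerProductSpace ℝ E] [CompleteSpace E]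
    (ρ : E → ℝ) (p : E) (hρ : ContDiff ℝ 2 ρ) (hp : ρ p = 0) (hg : gradient ρ p ≠ 0)
    (v : E) (hv : fderiv ℝ ρ p v = 0) :
    ∃ γ : ℝ → E, γ 0 = p ∧ HasDerivAt γ v 0 ∧ ∀ᶠ t in 𝓝 0, ρ (γ t) = 0 := by
  have hs : HasStrictFDerivAt ρ (fderiv ℝ ρ p) p :=
    hρ.contDiffAt.hasStrictFDerivAt (by norm_num)
  have hne : fderiv ℝ ρ p ≠ 0 := by
    intro h; apply hg; rw [gradient, h, map_zero]
  have hr : (fderiv ℝ ρ p).range = ⊤ := by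
    rw [LinearMap.range_eq_top]
    apply LinearMap.surjective
    intro h
    apply hne
    ext x
    exact congrArg (fun l : E →ₗ[ℝ] ℝ => l x) h
  refine ⟨fun t => hs.implicitFunction ρ (fderiv ℝ ρ p) hr (ρ p)
    (t • (⟨v, hv⟩ : (fderiv ℝ ρ p).ker)), ?_, ?_, ?_⟩
  · simp
  · have h1 := (hs.to_implicitFunction hr).hasFDerivAt
    have h2 : HasDerivAt (fun t : ℝ => t • (⟨v, hv⟩ : (fderiv ℝ ρ p).ker)) (⟨v, hv⟩) 0 := by
      simpa using (hasDerivAt_id (0:ℝ)).smul_const (⟨v, hv⟩ : (fderiv ℝ ρ p).ker)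
    have h3 := HasFDerivAt.comp_hasDerivAt (f := fun t : ℝ => t • (⟨v, hv⟩ : (fderiv ℝ ρ p).ker))
      (0:ℝ) (by simpa using h1) h2
    simpa using! h3
  · have h1 := hs.map_implicitFunction_eq hr
    have hc : Tendsto (fun t : ℝ => (ρ p, t • (⟨v, hv⟩ : (fderiv ℝ ρ p).ker))) (𝓝 0)
        (𝓝 (ρ p, 0)) := by
      have : Continuous (fun t : ℝ => (ρ p, t • (⟨v, hv⟩ : (fderiv ℝ ρ p).ker))) := by fun_prop
      have h := this.tendsto 0
      simpa using h
    filter_upwards [hc.eventually h1] with t ht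
    exact ht.trans hp

/-- Derivative within `K` vanishes along the zero curve. -/
theorem aux_first {E : Type*} [NormedAddCommGroup E] [InnerProductSpace ℝ E] [CompleteSpace E]
    (ρ : E → ℝ) (p : E) (hρ : ContDiff ℝ 2 ρ) (hp : ρ p = 0) (hg : gradient ρ p ≠ 0)
    (v : E) (hv : fderiv ℝ ρ p v = 0) (K : Set E) (hK : ∀ x, ρ x = 0 → x ∈ K)
    (f : E → ℝ) (f' : E →L[ℝ] ℝ) (hf : HasFDerivWithinAt f f' K p)
    (h0 : ∀ x, ρ x = 0 → f x = 0) : f' v = 0 := by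
  obtain ⟨γ, hγ0, hγ, hev⟩ := aux_curve ρ p hρ hp hg v hv
  subst hγ0
  set T : Set ℝ := {t | ρ (γ t) = 0}
  have h1 : HasDerivWithinAt (f ∘ γ) (f' v) T 0 :=
    hf.comp_hasDerivWithinAt (0:ℝ) hγ.hasDerivWithinAt (fun t ht => hK _ ht)
  have h2 : HasDerivAt (f ∘ γ) (f' v) 0 := h1.hasDerivAt hev
  have h3 : HasDerivAt (f ∘ γ) 0 0 := by
    refine (hasDerivAt_const (0:ℝ) (0:ℝ)).congr_of_eventuallyEq ?_
    filter_upwards [hev] with t ht using h0 _ ht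
  exact h2.unique h3

theorem aux_second {E : Type*} [NormedAddCommGroup E] [InnerProductSpace ℝ E] [CompleteSpace E]
    (ρ : E → ℝ) (hρ : ContDiff ℝ 2 ρ) (K : Set E) (hK : ∀ x, ρ x = 0 → x ∈ K)
    (hν : ∀ x, ρ x = 0 → gradient ρ x ≠ 0)
    (hsc : ∀ x, ρ x = 0 → ∀ v : E, v ≠ 0 → ⟪gradient ρ x, v⟫ = 0 →
      0 < fderiv ℝ (fun y => fderiv ℝ ρ y v) x v)
    (φ : E → ℝ) (F : E → E →L[ℝ] ℝ) (H : E → E →L[ℝ] E →L[ℝ] ℝ)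
    (hF : ∀ x ∈ K, HasFDerivWithinAt φ (F x) K x)
    (hH : ∀ x ∈ K, HasFDerivWithinAt F (H x) K x)
    (h0 : ∀ x, ρ x = 0 → φ x = 0)
    (hφν : ∀ x, ρ x = 0 → F x (gradient ρ x) < 0)
    (p : E) (hp : ρ p = 0) (v : E) (hv : v ≠ 0) (hFv : F p v = 0) : H p v v < 0 := by
  set g := gradient ρ p with hgdef
  have hL : ∀ v, fderiv ℝ ρ p v = ⟪g, v⟫ := fun v => by
    rw [hgdef, gradient, InnerProductSpace.toDual_symm_apply]
  have hgn : 0 < ‖g‖ ^ 2 := by have := norm_pos_iff.2 (hν p hp); positivity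
  have hLg : fderiv ℝ ρ p g = ‖g‖ ^ 2 := by rw [hL, real_inner_self_eq_norm_sq]
  have first : ∀ x, ρ x = 0 → ∀ w, fderiv ℝ ρ x w = 0 → F x w = 0 := fun x hx w hw =>
    aux_first ρ x hρ hx (hν x hx) w hw K hK φ (F x) (hF x (hK x hx)) h0
  have hFg := hφν p hp
  rw [← hgdef] at hFg
  have tang : ∀ x, ρ x = 0 → fderiv ℝ ρ x g * F x v - fderiv ℝ ρ x v * F x g = 0 := by
    intro x hx
    have := first x hx (fderiv ℝ ρ x g • v - fderiv ℝ ρ x v • g) (by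
      simp only [map_sub, map_smul, smul_eq_mul]; ring)
    simpa only [map_sub, map_smul, smul_eq_mul] using this
  have hLv : fderiv ℝ ρ p v = 0 := by
    have := tang p hp
    rw [hFv] at this
    have h : fderiv ℝ ρ p v * F p g = 0 := by linarith
    exact (mul_eq_zero.1 h).resolve_right hFg.ne
  have hD : HasFDerivAt (fderiv ℝ ρ) (fderiv ℝ (fderiv ℝ ρ) p) p :=
    ((hρ.fderiv_right (m := 1) (by norm_num)).differentiable (by norm_num) p).hasFDerivAt
  have hDw : ∀ w, HasFDerivWithinAt (fun x => fderiv ℝ ρ x w)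
      ((fderiv ℝ (fderiv ℝ ρ) p).flip w) K p := fun w => by
    have := (hD.clm_apply (hasFDerivAt_const w p)).hasFDerivWithinAt (s := K)
    simpa using this
  have hHw : ∀ w, HasFDerivWithinAt (fun x => F x w) ((H p).flip w) K p := fun w => by
    have := (hH p (hK p hp)).clm_apply (hasFDerivWithinAt_const w p K)
    simpa using this
  have hG := ((hDw g).mul (hHw v)).sub ((hDw v).mul (hHw g))
  have key := aux_first ρ p hρ hp (hν p hp) v hLv K hK _ _ hG tang
  simp only [ContinuousLinearMap.sub_apply, ContinuousLinearMap.add_apply,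
    ContinuousLinearMap.smul_apply, ContinuousLinearMap.flip_apply, smul_eq_mul, hLv, hFv, hLg]
    at key
  have hpos := hsc p hp v hv (by rw [← hgdef, ← hL, hLv])
  have e : fderiv ℝ (fun y => fderiv ℝ ρ y v) p v = fderiv ℝ (fderiv ℝ ρ) p v v := by
    have := hD.clm_apply (hasFDerivAt_const v p)
    rw [this.fderiv]; simp
  rw [e] at hpos
  have : fderiv ℝ (fderiv ℝ ρ) p v v * F p g < 0 := mul_neg_of_pos_of_neg hpos hFg
  by_contra hcon
  push Not at hcon
  have := mul_nonneg hgn.le hcon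
  linarith

theorem aux_delta {E : Type*} [NormedAddCommGroup E] [InnerProductSpace ℝ E]
    [FiniteDimensional ℝ E]
    (K : Set E) (hKc : IsCompact K)
    (φ : E → ℝ) (F : E → E →L[ℝ] ℝ) (H : E → E →L[ℝ] E →L[ℝ] ℝ)
    (hφc : ContinuousOn φ K) (hFc : ContinuousOn F K) (hHc : ContinuousOn H K)
    (hφ0 : ∀ x ∈ K, 0 ≤ φ x)
    (hb : ∀ x ∈ K, φ x = 0 → ∀ v, v ≠ 0 → F x v = 0 → H x v v < 0) :
    ∃ δ > (0:ℝ), ∀ x ∈ K, 0 < φ x → φ x < δ → ∀ v, φ x * H x v v ≤ (F x v) ^ 2 := by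
  have hS : IsCompact (K ×ˢ Metric.sphere (0:E) 1) := hKc.prod (isCompact_sphere _ _)
  have m1 : MapsTo Prod.fst (K ×ˢ Metric.sphere (0:E) 1) K := fun z hz => hz.1
  have c1 : ContinuousOn (fun z : E × E => φ z.1) (K ×ˢ Metric.sphere (0:E) 1) :=
    hφc.comp continuousOn_fst m1
  have c2 : ContinuousOn (fun z : E × E => F z.1 z.2) (K ×ˢ Metric.sphere (0:E) 1) :=
    (hFc.comp continuousOn_fst m1).clm_apply continuousOn_snd
  have c3 : ContinuousOn (fun z : E × E => H z.1 z.2 z.2) (K ×ˢ Metric.sphere (0:E) 1) :=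
    ((hHc.comp continuousOn_fst m1).clm_apply continuousOn_snd).clm_apply continuousOn_snd
  have c4 : ContinuousOn (fun z : E × E => (φ z.1 * H z.1 z.2 z.2 - (F z.1 z.2) ^ 2,
      H z.1 z.2 z.2)) (K ×ˢ Metric.sphere (0:E) 1) := ((c1.mul c3).sub (c2.pow 2)).prodMk c3
  have hclosed := c4.preimage_isClosed_of_isClosed hS.isClosed
    ((isClosed_Ici (a := (0:ℝ))).prod (isClosed_Ici (a := (0:ℝ))))
  have hC := hS.of_isClosed_subset hclosed inter_subset_left
  obtain ⟨δ, hδ, hmin⟩ := hC.exists_forall_le' (c1.mono inter_subset_left) (a := 0) (by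
    rintro ⟨z, v⟩ ⟨⟨hz, hv⟩, h1, h2⟩
    simp only [mem_Ici] at h1 h2
    refine lt_of_le_of_ne (hφ0 z hz) fun h => ?_
    simp only at h
    rw [← h] at h1
    have hF0 : F z v = 0 := by
      have : (F z v) ^ 2 = 0 := le_antisymm (by linarith) (sq_nonneg _)
      exact pow_eq_zero_iff (two_ne_zero) |>.1 this
    have hv0 : v ≠ 0 := by
      rintro rfl
      simp at hv
    exact absurd (hb z hz h.symm v hv0 hF0) (not_lt.2 h2))
  refine ⟨δ, hδ, fun x hx hpos hlt v => ?_⟩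
  by_contra hcon
  push Not at hcon
  have hv0 : v ≠ 0 := by
    rintro rfl
    simp at hcon
  have hvn : 0 < ‖v‖⁻¹ := inv_pos.2 (norm_pos_iff.2 hv0)
  have hH : 0 < H x v v := by
    have := lt_of_le_of_lt (sq_nonneg _) hcon
    exact (pos_iff_pos_of_mul_pos this).1 hpos
  have := hmin (x, ‖v‖⁻¹ • v) ⟨⟨hx, by simp [norm_smul, hv0]⟩, by
    simp only [map_smul, ContinuousLinearMap.smul_apply, smul_eq_mul, mem_Ici]
    have := mul_pos (pow_pos hvn 2) (sub_pos.2 hcon)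
    nlinarith, by
    simp only [map_smul, ContinuousLinearMap.smul_apply, smul_eq_mul, mem_Ici]
    positivity⟩
  simp only at this
  linarith

theorem aux_mono {E : Type*} [NormedAddCommGroup E] [InnerProductSpace ℝ E] [CompleteSpace E]
    (Ω : Set E) (φ : E → ℝ) (F : E → E →L[ℝ] ℝ) (H : E → E →L[ℝ] E →L[ℝ] ℝ)
    (hF : ∀ x ∈ Ω, HasFDerivAt φ (F x) x)
    (hH : ∀ x ∈ Ω, HasFDerivAt F (H x) x)
    (hpos : ∀ x ∈ Ω, 0 < φ x) (x y : E)
    (hseg : ∀ z ∈ segment ℝ x y, z ∈ Ω ∧ ∀ v, φ z * H z v v ≤ (F z v) ^ 2) :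
    0 ≤ ⟪gradient (fun z => Real.log (φ z)) x - gradient (fun z => Real.log (φ z)) y, y - x⟫ := by
  have hgrad : ∀ z ∈ Ω, ⟪gradient (fun z => Real.log (φ z)) z, y - x⟫ = F z (y - x) / φ z := by
    intro z hz
    rw [gradient, InnerProductSpace.toDual_symm_apply, ((hF z hz).log (hpos z hz).ne').fderiv]
    simp [div_eq_inv_mul]
  have hmem : ∀ t ∈ Icc (0:ℝ) 1, x + t • (y - x) ∈ segment ℝ x y := fun t ht => by
    rw [segment_eq_image']; exact ⟨t, ht, rfl⟩
  have hl : ∀ t : ℝ, HasDerivAt (fun t : ℝ => x + t • (y - x)) (y - x) t := fun t => by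
    simpa using ((hasDerivAt_id t).smul_const (y - x)).const_add x
  have hder : ∀ t ∈ Icc (0:ℝ) 1, HasDerivAt
      (fun t : ℝ => F (x + t • (y - x)) (y - x) / φ (x + t • (y - x)))
      ((H (x + t • (y - x)) (y - x) (y - x) * φ (x + t • (y - x))
        - F (x + t • (y - x)) (y - x) * F (x + t • (y - x)) (y - x)) /
          (φ (x + t • (y - x))) ^ 2) t := by
    intro t ht
    have hz := (hseg _ (hmem t ht)).1
    have h1 : HasDerivAt (fun t : ℝ => φ (x + t • (y - x))) (F (x + t • (y - x)) (y - x)) t :=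
      (hF _ hz).comp_hasDerivAt t (hl t)
    have h2 : HasDerivAt (fun t : ℝ => F (x + t • (y - x))) (H (x + t • (y - x)) (y - x)) t :=
      (hH _ hz).comp_hasDerivAt t (hl t)
    have h3 : HasDerivAt (fun t : ℝ => F (x + t • (y - x)) (y - x))
        (H (x + t • (y - x)) (y - x) (y - x)) t := by
      simpa using h2.clm_apply (hasDerivAt_const t (y - x))
    exact h3.div h1 (hpos _ hz).ne'
  have hanti := antitoneOn_of_deriv_nonpos (convex_Icc (0:ℝ) 1)
    (fun t ht => (hder t ht).continuousAt.continuousWithinAt)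
    (fun t ht => (hder t (interior_subset ht)).differentiableAt.differentiableWithinAt)
    (fun t ht => by
      have ht' := interior_subset ht
      rw [(hder t ht').deriv]
      have := (hseg _ (hmem t ht')).2 (y - x)
      exact div_nonpos_of_nonpos_of_nonneg (by nlinarith) (sq_nonneg _))
  have h01 := hanti (left_mem_Icc.2 zero_le_one) (right_mem_Icc.2 zero_le_one) zero_le_one
  simp only [zero_smul, add_zero, one_smul, add_sub_cancel] at h01
  rw [inner_sub_left, hgrad x (hseg x (left_mem_segment ℝ x y)).1,
    hgrad y (hseg y (right_mem_segment ℝ x y)).1]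
  linarith

theorem stmt_17 {n : ℕ}
    (Ω : Set (EuclideanSpace ℝ (Fin n))) (ρ : EuclideanSpace ℝ (Fin n) → ℝ)
    (hΩ : IsOpen Ω) (hbd : Bornology.IsBounded Ω)
    (hρ : ContDiff ℝ 2 ρ)
    (hΩρ : Ω = {x | ρ x < 0})
    (hfr : frontier Ω = {x | ρ x = 0})
    (hν : ∀ x ∈ frontier Ω, gradient ρ x ≠ 0)
    (hsc : ∀ x ∈ frontier Ω, ∀ v : EuclideanSpace ℝ (Fin n), v ≠ 0 → ⟪gradient ρ x, v⟫ = 0 →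
      0 < fderiv ℝ (fun y => fderiv ℝ ρ y v) x v)
    (q : EuclideanSpace ℝ (Fin n) → ℝ) (hqC : ContDiffOn ℝ 1 q (closure Ω))
    (φ₀ : EuclideanSpace ℝ (Fin n) → ℝ) (lam0 : ℝ)
    (hφC : ContDiffOn ℝ 2 φ₀ (closure Ω))
    (hφpos : ∀ x ∈ Ω, 0 < φ₀ x)
    (hφbd : ∀ x ∈ frontier Ω, φ₀ x = 0)
    (hφν : ∀ x ∈ frontier Ω, fderivWithin ℝ φ₀ (closure Ω) x (gradient ρ x) < 0)
    (heig : ∀ x ∈ Ω, lap φ₀ x - q x * φ₀ x = -lam0 * φ₀ x)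
 :
    ∃ δ₁ > (0:ℝ), ∀ x ∈ Ω, ∀ y ∈ Ω,
      segment ℝ x y ⊆ {z ∈ Ω | φ₀ z < δ₁} →
      0 ≤ ⟪gradient (fun z => Real.log (φ₀ z)) x - gradient (fun z => Real.log (φ₀ z)) y,
          y - x⟫ := by
  have hΩeq : ∀ x, x ∈ Ω ↔ ρ x < 0 := fun x => by rw [hΩρ]; rfl
  have hfeq : ∀ x, x ∈ frontier Ω ↔ ρ x = 0 := fun x => by rw [hfr]; rfl
  have hcl : ∀ x ∈ closure Ω, x ∈ Ω ∨ ρ x = 0 := fun x hx => by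
    rw [closure_eq_self_union_frontier] at hx
    exact hx.imp id (hfeq x).1
  have hK : ∀ x, ρ x = 0 → x ∈ closure Ω := fun x hx => frontier_subset_closure ((hfeq x).2 hx)
  have hKc : IsCompact (closure Ω) := hbd.isCompact_closure
  have hud : UniqueDiffOn ℝ (closure Ω) := by
    intro x hx
    rcases hcl x hx with h | h
    · exact (hΩ.uniqueDiffWithinAt h).mono subset_closure
    · have := aux_unique ρ x (hρ.differentiable (by norm_num) x) h (hν x ((hfeq x).2 h))
      rw [← hΩρ] at this
      exact this.mono subset_closure
  set K := closure Ω with hKdef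
  set F := fderivWithin ℝ φ₀ K with hFdef
  set H := fderivWithin ℝ F K with hHdef
  have hFC : ContDiffOn ℝ 1 F K := hφC.fderivWithin hud (by norm_num)
  have hF : ∀ x ∈ K, HasFDerivWithinAt φ₀ (F x) K x := fun x hx =>
    (hφC.differentiableOn (by norm_num) x hx).hasFDerivWithinAt
  have hH : ∀ x ∈ K, HasFDerivWithinAt F (H x) K x := fun x hx =>
    (hFC.differentiableOn (by norm_num) x hx).hasFDerivWithinAt
  have hHc : ContinuousOn H K := hFC.continuousOn_fderivWithin hud le_rfl
  have hnhds : ∀ x ∈ Ω, K ∈ nhds x := fun x hx =>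
    Filter.mem_of_superset (hΩ.mem_nhds hx) subset_closure
  obtain ⟨δ, hδ, hmain⟩ := aux_delta K hKc φ₀ F H hφC.continuousOn hFC.continuousOn hHc
    (fun x hx => by
      rcases hcl x hx with h | h
      · exact (hφpos x h).le
      · exact (hφbd x ((hfeq x).2 h)).ge)
    (fun x hx h0 v hv hFv => by
      have hx0 : ρ x = 0 := (hcl x hx).resolve_left fun h => (hφpos x h).ne' h0
      exact aux_second ρ hρ K hK (fun x hx => hν x ((hfeq x).2 hx))
        (fun x hx => hsc x ((hfeq x).2 hx)) φ₀ F H hF hH (fun x hx => hφbd x ((hfeq x).2 hx))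
        (fun x hx => hφν x ((hfeq x).2 hx)) x hx0 v hv hFv)
  refine ⟨δ, hδ, fun x _ y _ hseg => ?_⟩
  refine aux_mono Ω φ₀ F H (fun z hz => (hF z (subset_closure hz)).hasFDerivAt (hnhds z hz))
    (fun z hz => (hH z (subset_closure hz)).hasFDerivAt (hnhds z hz)) hφpos x y ?_
  intro z hz
  obtain ⟨h1, h2⟩ := hseg hz
  exact ⟨h1, hmain z (subset_closure h1) (hφpos z h1) h2⟩
end
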